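/- arXiv:2512.04101 — 2 statements merged into one kernel-verified Lean document; each statement's English description precedes it below -/
import Mathlib

section
/- Let n ≥ 1, let Ω ⊆ ℝⁿ be a bounded open set, let A be a real n×n matrix, and let φ : ℝⁿ → ℝⁿ be a C^∞ map with compact support contained in Ω. Then ∫_Ω det(A + Dφ(x)) dx = det(A) · m(Ω), where m(Ω) is the Lebesgue measure of Ω and A + Dφ(x) denotes the n×n matrix whose (j,i) entry is A_{ji} + ∂φʲ/∂xⁱ(x). -/
open MeasureTheory

/-- The integral of `det (1 + t M(x))` over a bounded set is a polynomial in `t`. -/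
theorem exists_polynomial_eval_eq_setIntegral_det_one_add_smul {n : ℕ}
    {Ω : Set (Fin n → ℝ)} (hΩ : Bornology.IsBounded Ω)
    {M : (Fin n → ℝ) → Matrix (Fin n) (Fin n) ℝ} (hM : Continuous M) :
    ∃ q : Polynomial ℝ, ∀ t : ℝ,
      ∫ x in Ω, (1 + t • M x).det = q.eval t := by
  let N : Matrix (Fin n) (Fin n) C(Fin n → ℝ, ℝ) :=
    Matrix.of fun i j => ⟨fun x => M x i j, hM.matrix_elem i j⟩
  let p : Polynomial C(Fin n → ℝ, ℝ) :=
    (1 + (Polynomial.X : Polynomial C(Fin n → ℝ, ℝ)) • N.map Polynomial.C).det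
  have hp (t : ℝ) (x : Fin n → ℝ) :
      (1 + t • M x).det = ∑ k ∈ Finset.range (p.natDegree + 1), p.coeff k x * t ^ k := by
    let ev : C(Fin n → ℝ, ℝ) →+* ℝ := (ContinuousMap.evalAlgHom ℝ ℝ x).toRingHom
    have h : (p.eval₂ ev t) = (1 + t • M x).det := by
      rw [← Polynomial.coe_eval₂RingHom, RingHom.map_det]
      congr 1
      ext i j
      by_cases hij : i = j <;>
        simp [N, ev, hij, mul_comm t]
    rw [← h, Polynomial.eval₂_eq_sum_range]
    rfl
  have hint (k : ℕ) : IntegrableOn (p.coeff k) Ω :=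
    ((p.coeff k).continuous.continuousOn.integrableOn_compact
      hΩ.isCompact_closure).mono_set subset_closure
  refine ⟨∑ k ∈ Finset.range (p.natDegree + 1),
    Polynomial.C (∫ x in Ω, p.coeff k x) * Polynomial.X ^ k, fun t => ?_⟩
  simp_rw [hp, Polynomial.eval_finsetSum]
  rw [integral_finsetSum _ fun k _ => (hint k).mul_const _]
  simp [integral_mul_const]

theorem LipschitzWith.bijective_id_add {E : Type*} [NormedAddCommGroup E] [NormedSpace ℝ E]
    [CompleteSpace E] {c : NNReal} {h : E → E} (hh : LipschitzWith c h) (hc : c < 1) :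
    Function.Bijective fun x => x + h x := by
  constructor
  · intro x y hxy
    have h1 : x - y = h y - h x := by
      have : x + h x = y + h y := hxy
      rw [sub_eq_sub_iff_add_eq_add, this, add_comm]
    have h2 := hh.norm_sub_le y x
    rw [← h1, norm_sub_rev y x] at h2
    have h3 : (c : ℝ) < 1 := hc
    have h4 : ‖x - y‖ = 0 := by nlinarith [norm_nonneg (x - y)]
    exact sub_eq_zero.mp (norm_eq_zero.mp h4)
  · intro y
    have hk : ContractingWith c fun x => y - h x :=
      ⟨hc, LipschitzWith.of_dist_le_mul fun a b => by
        rw [dist_sub_left]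
        exact hh.dist_le_mul a b⟩
    have hfix : y - h hk.fixedPoint = hk.fixedPoint := hk.fixedPoint_isFixedPt
    exact ⟨hk.fixedPoint, by rw [← eq_sub_iff_add_eq]; exact hfix.symm⟩

/-- If two bijections agree off `s`, they have the same image of `s`. -/
theorem Function.Bijective.image_eq_of_eqOn_compl {α β : Type*} {f g : α → β}
    (hf : Function.Bijective f) (hg : Function.Bijective g) {s : Set α}
    (h : Set.EqOn f g sᶜ) : f '' s = g '' s := by
  rw [← compl_inj_iff, ← Set.image_compl_eq hf, ← Set.image_compl_eq hg]
  exact h.image_eq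

theorem integral_det_add_jacobian_compact_support
    (n : ℕ) (hn : 1 ≤ n)
    (Ω : Set (Fin n → ℝ)) (hΩopen : IsOpen Ω) (hΩbdd : Bornology.IsBounded Ω)
    (A : Matrix (Fin n) (Fin n) ℝ)
    (φ : (Fin n → ℝ) → Fin n → ℝ)
    (hφ : ContDiff ℝ (⊤ : ℕ∞) φ)
    (hsupp : HasCompactSupport φ) (hsuppΩ : tsupport φ ⊆ Ω) :
    ∫ x in Ω, Matrix.det (A + Matrix.of fun j i : Fin n =>
        fderiv ℝ (fun y => φ y j) x (Pi.single i 1)) ∂volume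
      = A.det * (volume Ω).toReal := by
  have hφ1 : ContDiff ℝ 1 φ := hφ.of_le (by exact_mod_cast le_top)
  have hdiff : Differentiable ℝ φ := hφ1.differentiable one_ne_zero
  let L : (Fin n → ℝ) →L[ℝ] (Fin n → ℝ) := LinearMap.toContinuousLinearMap (A - 1).toLin'
  let J : (Fin n → ℝ) → Matrix (Fin n) (Fin n) ℝ := fun x =>
    LinearMap.toMatrix' (fderiv ℝ φ x : (Fin n → ℝ) →ₗ[ℝ] (Fin n → ℝ))
  have hJ (x : Fin n → ℝ) : (Matrix.of fun j i : Fin n =>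
      fderiv ℝ (fun y => φ y j) x (Pi.single i 1)) = J x := by
    ext j i
    simp only [J, Matrix.of_apply, LinearMap.toMatrix'_apply]
    rw [((hasFDerivAt_pi'.mp (hdiff x).hasFDerivAt) j).fderiv]
    simp
  have hJcont : Continuous J := by
    refine continuous_matrix fun i j => ?_
    have := (hφ1.continuous_fderiv one_ne_zero).clm_apply
      (continuous_const (y := (Pi.single j 1 : Fin n → ℝ)))
    simpa [J, LinearMap.toMatrix'_apply] using continuous_pi_iff.mp this i
  have hdetL (t : ℝ) (x : Fin n → ℝ) :
      (1 + t • ((A - 1) + J x)).det =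
        (ContinuousLinearMap.id ℝ (Fin n → ℝ) + t • (L + fderiv ℝ φ x)).det := by
    rw [ContinuousLinearMap.det, ← LinearMap.det_toMatrix']
    congr 1
    simp [L, J]
  have hdetL₀ (t : ℝ) : (1 + t • (A - 1)).det =
        (ContinuousLinearMap.id ℝ (Fin n → ℝ) + t • L).det := by
    rw [ContinuousLinearMap.det, ← LinearMap.det_toMatrix']
    congr 1
    simp [L]
  obtain ⟨C, hC⟩ := hφ1.lipschitzWith_of_hasCompactSupport hsupp one_ne_zero
  have hψ : LipschitzWith (‖L‖₊ + C) fun x => L x + φ x := L.lipschitz.add hC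
  set K : NNReal := ‖L‖₊ + C with hK
  have hL : LipschitzWith K L := L.lipschitz.weaken (by simp [hK])
  have hLnorm : ‖L‖ ≤ K := by simp [hK]
  have hψ' (x : Fin n → ℝ) : HasFDerivAt (fun x => L x + φ x) (L + fderiv ℝ φ x) x :=
    L.hasFDerivAt.add (hdiff x).hasFDerivAt
  have hψnorm (x : Fin n → ℝ) : ‖L + fderiv ℝ φ x‖ ≤ K := by
    rw [← (hψ' x).fderiv]
    exact norm_fderiv_le_of_lipschitz ℝ hψ
  obtain ⟨δ, hδ, hdetpos⟩ : ∃ δ > 0, ∀ B : (Fin n → ℝ) →L[ℝ] (Fin n → ℝ), ‖B‖ < δ →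
      0 < (ContinuousLinearMap.id ℝ (Fin n → ℝ) + B).det := by
    have hc : Continuous fun B : (Fin n → ℝ) →L[ℝ] (Fin n → ℝ) =>
        (ContinuousLinearMap.id ℝ (Fin n → ℝ) + B).det :=
      ContinuousLinearMap.continuous_det.comp (continuous_const.add continuous_id)
    have h0 : (0 : ℝ) < (ContinuousLinearMap.id ℝ (Fin n → ℝ) + 0).det := by
      simp [ContinuousLinearMap.det]
    obtain ⟨δ, hδ, h⟩ := Metric.eventually_nhds_iff.mp (hc.continuousAt.eventually_const_lt h0)
    exact ⟨δ, hδ, fun B hB => h (by simpa using hB)⟩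
  have hsmall (t : ℝ) (ht : 0 < t) (ht1 : t * K < 1) (htδ : t * K < δ) :
      ∫ x in Ω, (1 + t • ((A - 1) + J x)).det = ∫ x in Ω, (1 + t • (A - 1)).det := by
    have hlip {h : (Fin n → ℝ) → (Fin n → ℝ)} (hh : LipschitzWith K h) :
        Function.Bijective fun x => x + t • h x := by
      refine LipschitzWith.bijective_id_add (c := ‖t‖₊ * K)
        ((lipschitzWith_smul t).comp hh) ?_
      rw [← NNReal.coe_lt_coe]
      simpa [abs_of_pos ht] using ht1
    have hpos {B : (Fin n → ℝ) →L[ℝ] (Fin n → ℝ)} (hB : ‖B‖ ≤ K) :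
        0 < (ContinuousLinearMap.id ℝ (Fin n → ℝ) + t • B).det := by
      refine hdetpos _ (lt_of_le_of_lt ?_ htδ)
      rw [norm_smul, Real.norm_of_nonneg ht.le]
      gcongr
    have hvol {h : (Fin n → ℝ) → (Fin n → ℝ)}
        {h' : (Fin n → ℝ) → (Fin n → ℝ) →L[ℝ] (Fin n → ℝ)}
        (hh : LipschitzWith K h) (hh' : ∀ x, HasFDerivAt h (h' x) x) (hn' : ∀ x, ‖h' x‖ ≤ K) :
        ∫ x in Ω, (ContinuousLinearMap.id ℝ (Fin n → ℝ) + t • h' x).det =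
          ∫ _ in (fun x => x + t • h x) '' Ω, (1 : ℝ) := by
      rw [integral_image_eq_integral_abs_det_fderiv_smul volume (f := fun x => x + t • h x)
        hΩopen.measurableSet (fun x _ => ((hasFDerivAt_id x).add ((hh' x).const_smul t)).hasFDerivWithinAt)
        (hlip hh).injective.injOn]
      refine integral_congr_ae (.of_forall fun x => ?_)
      simp only [smul_eq_mul, mul_one]
      exact (abs_of_pos (hpos (hn' x))).symm
    simp_rw [hdetL, hdetL₀]
    rw [hvol hψ hψ' hψnorm, hvol hL (fun _ => L.hasFDerivAt) (fun _ => hLnorm),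
      (hlip hψ).image_eq_of_eqOn_compl (hlip hL)]
    intro x hx
    have : φ x = 0 := image_eq_zero_of_notMem_tsupport fun h => hx (hsuppΩ h)
    simp [this]
  obtain ⟨q, hq⟩ := exists_polynomial_eval_eq_setIntegral_det_one_add_smul hΩbdd
    (M := fun x => (A - 1) + J x) (continuous_const.add hJcont)
  obtain ⟨r, hr⟩ := exists_polynomial_eval_eq_setIntegral_det_one_add_smul hΩbdd
    (M := fun _ => A - 1) continuous_const
  have hqr : q = r := by
    have hKpos : (0 : ℝ) < K + 1 := by positivity
    refine Polynomial.eq_of_infinite_eval_eq q r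
      ((Set.Ioo_infinite (show (0 : ℝ) < min 1 δ / (K + 1) by positivity)).mono ?_)
    rintro t ⟨ht0, ht⟩
    rw [lt_div_iff₀ hKpos, lt_min_iff] at ht
    rw [Set.mem_ofPred_eq, ← hq, ← hr]
    exact hsmall t ht0 (by nlinarith [ht.1]) (by nlinarith [ht.2])
  have h1 := (hq 1).trans ((congrArg (Polynomial.eval 1) hqr).trans (hr 1).symm)
  simp_rw [hJ]
  simpa [← add_assoc, mul_comm, Measure.real] using h1
end

section
/- Let n ≥ 1 and let B denote the closed unit ball in ℝⁿ. Every map f : ℝⁿ → ℝⁿ that is C² on an open neighborhood of B and maps B into B has a fixed point in B: there exists x ∈ B with f(x) = x (smooth Brouwer fixed point theorem). -/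
open MeasureTheory Metric Set Polynomial

section Determinant

variable {E : Type*} [NormedAddCommGroup E] [NormedSpace ℝ E] [FiniteDimensional ℝ E]

lemma ContinuousLinearMap.exists_ne_zero_apply_eq_zero_of_det_eq_zero {A : E →L[ℝ] E}
    (hA : A.det = 0) : ∃ v, v ≠ 0 ∧ A v = 0 := by
  obtain ⟨v, hv, hv0⟩ := (Submodule.ne_bot_iff _).1 (LinearMap.bot_lt_ker_of_det_eq_zero hA).ne'
  exact ⟨v, hv0, hv⟩

lemma ContinuousLinearMap.det_one_add_smul_pos {A : E →L[ℝ] E} {K t : ℝ} (hA : ‖A‖ ≤ K)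
    (ht : 0 ≤ t) (htK : t * K < 1) : 0 < (1 + t • A).det := by
  by_contra! h
  have hcont : ContinuousOn (fun s : ℝ => (1 + s • A).det) (Icc 0 t) :=
    (ContinuousLinearMap.continuous_det.comp (by fun_prop)).continuousOn
  have hone : (1 + (0 : ℝ) • A).det = 1 := by
    simp [ContinuousLinearMap.det]
  obtain ⟨s, hs, hs0⟩ := intermediate_value_Icc' ht hcont
    (show (0 : ℝ) ∈ _ from ⟨h, hone.symm ▸ zero_le_one⟩)
  obtain ⟨v, hv, hv0⟩ := exists_ne_zero_apply_eq_zero_of_det_eq_zero hs0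
  have hv' : v = -(s • A v) := eq_neg_of_add_eq_zero_left (by simpa using hv0)
  have hpos : 0 < ‖v‖ := norm_pos_iff.2 hv
  have hle : ‖v‖ ≤ t * K * ‖v‖ := by
    calc ‖v‖ = s * ‖A v‖ := by
          conv_lhs => rw [hv', norm_neg, norm_smul, Real.norm_of_nonneg hs.1]
      _ ≤ t * (K * ‖v‖) := by
          gcongr
          · exact hs.2
          · exact A.le_of_opNorm_le hA v
      _ = t * K * ‖v‖ := by ring
  nlinarith

lemma ContinuousLinearMap.exists_polynomial_det_one_add_smul (A : E →L[ℝ] E) :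
    ∃ p : ℝ[X], p.natDegree ≤ Module.finrank ℝ E ∧ ∀ t, p.eval t = (1 + t • A).det := by
  let b := Module.finBasis ℝ E
  let M := LinearMap.toMatrix b b (A : E →ₗ[ℝ] E)
  refine ⟨Matrix.det ((X : ℝ[X]) • M.map C + (1 : Matrix _ _ ℝ).map C), ?_, fun t => ?_⟩
  · simpa using natDegree_det_X_add_C_le M 1
  · rw [ContinuousLinearMap.det, ← LinearMap.det_toMatrix b, eval_det]
    congr 1
    ext i j
    simp [M, LinearMap.toMatrix_one, mul_comm, add_comm]

end Determinant

lemma Polynomial.exists_forall_eval_one_eq_sum (n : ℕ) {ε : ℝ} (hε : 0 < ε) :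
    ∃ c v : Fin (n + 1) → ℝ, (∀ i, 0 ≤ v i ∧ v i ≤ ε) ∧
      ∀ p : ℝ[X], p.natDegree ≤ n → p.eval 1 = ∑ i, c i * p.eval (v i) := by
  let v : Fin (n + 1) → ℝ := fun i => ε * (i / (n + 1))
  have hv : Function.Injective v := by
    intro i j hij
    have hn : (n + 1 : ℝ) ≠ 0 := by positivity
    have := mul_left_cancel₀ hε.ne' hij
    field_simp at this
    exact Fin.ext (by exact_mod_cast this)
  refine ⟨fun i => (Lagrange.basis Finset.univ v i).eval 1, v, fun i => ⟨by positivity, ?_⟩,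
    fun p hp => ?_⟩
  · refine mul_le_of_le_one_right hε.le ((div_le_one (by positivity)).2 ?_)
    exact_mod_cast i.2.le
  · have hdeg : p.degree < (Finset.univ : Finset (Fin (n + 1))).card := by
      rw [Finset.card_fin]
      exact (degree_le_of_natDegree_le hp).trans_lt (by exact_mod_cast n.lt_succ_self)
    conv_lhs => rw [Lagrange.eq_interpolate (v := v) hv.injOn hdeg]
    simp [Lagrange.interpolate_apply, eval_finsetSum, mul_comm]

section Perturbation

variable {E : Type*} [NormedAddCommGroup E] [NormedSpace ℝ E]

lemma LipschitzWith.bijective_add_smul [CompleteSpace E] {h : E → E} {K : NNReal} {t : ℝ}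
    (hh : LipschitzWith K h)
    (ht : 0 ≤ t) (htK : t * K < 1) : Function.Bijective fun x => x + t • h x := by
  have hlip : ∀ x y, ‖t • h x - t • h y‖ ≤ t * K * ‖x - y‖ := fun x y => by
    rw [← smul_sub, norm_smul, Real.norm_of_nonneg ht, mul_assoc]
    exact mul_le_mul_of_nonneg_left (hh.norm_sub_le x y) ht
  constructor
  · intro x y hxy
    have h1 : x - y = -(t • h x - t • h y) := by
      have : x + t • h x = y + t • h y := hxy
      rw [neg_sub, sub_eq_sub_iff_add_eq_add, this, add_comm]
    have h2 := hlip x y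
    rw [← norm_neg (t • h x - t • h y), ← h1] at h2
    by_contra hne
    have := norm_sub_pos_iff.2 hne
    nlinarith
  · intro y
    have hc : ContractingWith (⟨t, ht⟩ * K) fun x => y - t • h x := by
      refine ⟨by exact_mod_cast htK, LipschitzWith.of_dist_le_mul fun a b => ?_⟩
      rw [dist_eq_norm, dist_eq_norm, sub_sub_sub_cancel_left, norm_sub_rev]
      exact hlip a b
    have hfix : y - t • h hc.fixedPoint = hc.fixedPoint := hc.fixedPoint_isFixedPt
    exact ⟨hc.fixedPoint, (sub_eq_iff_eq_add.1 hfix).symm⟩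

lemma LipschitzOnWith.lipschitzWith_indicator_closedBall {h : E → E} {K : NNReal}
    (hh : LipschitzOnWith K h (closedBall 0 1)) (h0 : ∀ x ∈ sphere (0 : E) 1, h x = 0) :
    LipschitzWith K ((closedBall 0 1).indicator h) := by
  have key : ∀ x ∈ closedBall (0 : E) 1, ∀ y ∉ closedBall (0 : E) 1, ‖h x‖ ≤ K * dist x y := by
    intro x hx y hy
    have hcont : ContinuousOn (fun s : ℝ => ‖AffineMap.lineMap x y s‖) (Icc 0 1) := by
      have : Continuous (fun s : ℝ => AffineMap.lineMap x y s) := AffineMap.lineMap_continuous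
      exact this.norm.continuousOn
    simp only [mem_closedBall, dist_zero_right, not_le] at hx hy
    obtain ⟨s, hs, hs1⟩ := intermediate_value_Icc zero_le_one hcont
      (show (1 : ℝ) ∈ _ from ⟨by simpa using hx, by simpa using hy.le⟩)
    have hz := h0 (AffineMap.lineMap x y s) (by simpa using hs1)
    have := hh.dist_le_mul x (by simpa using hx) (AffineMap.lineMap x y s) (by simpa using hs1.le)
    rw [hz, dist_zero_right, dist_left_lineMap, Real.norm_of_nonneg hs.1] at this
    refine this.trans (mul_le_mul_of_nonneg_left ?_ K.2)
    exact mul_le_of_le_one_left dist_nonneg hs.2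
  refine LipschitzWith.of_dist_le_mul fun x y => ?_
  by_cases hx : x ∈ closedBall (0 : E) 1 <;> by_cases hy : y ∈ closedBall (0 : E) 1
  · simpa only [indicator_of_mem hx, indicator_of_mem hy] using hh.dist_le_mul x hx y hy
  · simpa only [indicator_of_mem hx, indicator_of_notMem hy, dist_zero_right] using key x hx y hy
  · simpa only [indicator_of_notMem hx, indicator_of_mem hy, dist_zero_left, dist_comm y x]
      using key y hy x hx
  · simp only [indicator_of_notMem hx, indicator_of_notMem hy, dist_self]
    positivity

variable [FiniteDimensional ℝ E] [MeasurableSpace E] [BorelSpace E]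
  (μ : Measure E) [μ.IsAddHaarMeasure]

lemma integral_det_one_add_smul_fderiv {h : E → E} {K : NNReal} {t : ℝ} {s : Set E}
    (hs : MeasurableSet s) (hh : LipschitzWith K h)
    (h0 : ∀ x ∉ s, h x = 0) (hd : ∀ x ∈ s, DifferentiableAt ℝ h x)
    (ht : 0 ≤ t) (htK : t * K < 1) :
    ∫ x in s, (1 + t • fderiv ℝ h x).det ∂μ = μ.real s := by
  have hbij := hh.bijective_add_smul ht htK
  have himage : (fun x => x + t • h x) '' s = s := by
    rw [← compl_inj_iff, ← image_compl_eq hbij]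
    have : EqOn (fun x => x + t • h x) id sᶜ := fun x hx => by simp [h0 x hx]
    rw [this.image_eq, image_id]
  have hderiv : ∀ x ∈ s,
      HasFDerivWithinAt (fun x => x + t • h x) (1 + t • fderiv ℝ h x) s x := fun x hx =>
    ((hasFDerivAt_id x).add ((hd x hx).hasFDerivAt.const_smul t)).hasFDerivWithinAt
  have := integral_image_eq_integral_abs_det_fderiv_smul μ hs hderiv hbij.1.injOn (fun _ => (1 : ℝ))
  rw [himage] at this
  simp only [integral_const, smul_eq_mul, mul_one, measureReal_restrict_apply_univ] at this
  rw [this]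
  refine setIntegral_congr_fun hs fun x hx => ?_
  exact (abs_of_pos (ContinuousLinearMap.det_one_add_smul_pos
    ((hd x hx).hasFDerivAt.le_of_lipschitz hh) ht htK)).symm

lemma integral_det_one_add_fderiv {h : E → E} {K : NNReal} {s : Set E}
    (hs : MeasurableSet s) (hh : LipschitzWith K h)
    (h0 : ∀ x ∉ s, h x = 0) (hd : ∀ x ∈ s, DifferentiableAt ℝ h x)
    (hint : ∀ t : ℝ, IntegrableOn (fun x => (1 + t • fderiv ℝ h x).det) s μ) :
    ∫ x in s, (1 + fderiv ℝ h x).det ∂μ = μ.real s := by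
  have hε : (0 : ℝ) < 1 / (K + 1) := by positivity
  obtain ⟨c, v, hv, hc⟩ := exists_forall_eval_one_eq_sum (Module.finrank ℝ E) hε
  have hsum : ∑ i, c i = 1 := by simpa using (hc 1 (by simp)).symm
  have hdet : ∀ x, (1 + fderiv ℝ h x).det = ∑ i, c i * (1 + v i • fderiv ℝ h x).det := fun x => by
    obtain ⟨p, hp, hpe⟩ := (fderiv ℝ h x).exists_polynomial_det_one_add_smul
    simpa [hpe] using hc p hp
  simp_rw [hdet]
  rw [integral_finsetSum _ fun i _ => (hint (v i)).const_mul (c i)]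
  have hvK : ∀ i, v i * K < 1 := fun i => by
    calc v i * K ≤ 1 / (K + 1) * K := by gcongr; exact (hv i).2
      _ < 1 := by rw [one_div_mul_eq_div, div_lt_one (by positivity)]; linarith
  simp_rw [integral_const_mul,
    integral_det_one_add_smul_fderiv μ hs hh h0 hd (hv _).1 (hvK _)]
  rw [← Finset.sum_mul, hsum, one_mul]

end Perturbation

section Retraction

variable {E : Type*} [NormedAddCommGroup E] [InnerProductSpace ℝ E]

lemma det_fderiv_eq_zero_of_eventually_norm_eq_one
    [FiniteDimensional ℝ E] {r : E → E} {x : E}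
    (hd : DifferentiableAt ℝ r x) (hr : ∀ᶠ y in nhds x, ‖r y‖ = 1) : (fderiv ℝ r x).det = 0 := by
  by_contra hne
  have hunit : IsUnit (fderiv ℝ r x : E →ₗ[ℝ] E) :=
    (LinearMap.isUnit_iff_isUnit_det _).2 (isUnit_iff_ne_zero.2 hne)
  obtain ⟨v, hv⟩ := LinearMap.range_eq_top.1 ((LinearMap.isUnit_iff_range_eq_top _).1 hunit) (r x)
  have hconst : (fun y => ‖r y‖ ^ 2) =ᶠ[nhds x] fun _ => (1 : ℝ) :=
    hr.mono fun y hy => by simp [hy]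
  have hderiv := hd.hasFDerivAt.norm_sq.unique
    ((hasFDerivAt_const 1 x).congr_of_eventuallyEq hconst)
  have h2 := congrArg (fun L : E →L[ℝ] ℝ => L v) hderiv
  have hv' : fderiv ℝ r x v = r x := hv
  simp [hv', hr.self_of_nhds] at h2

lemma not_exists_contDiffOn_retraction_sphere
    [FiniteDimensional ℝ E] {r : E → E} {V : Set E} (hV : IsOpen V)
    (hBV : closedBall (0 : E) 1 ⊆ V) (hr : ContDiffOn ℝ 1 r V)
    (hnorm : ∀ x ∈ closedBall (0 : E) 1, ‖r x‖ = 1) (hid : ∀ x ∈ sphere (0 : E) 1, r x = x) :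
    False := by
  let _ : MeasurableSpace E := borel E
  have _ : BorelSpace E := ⟨rfl⟩
  let μ : Measure E := Measure.addHaar
  have hcompact : IsCompact (closedBall (0 : E) 1) := isCompact_closedBall 0 1
  have hball : ball (0 : E) 1 ⊆ closedBall 0 1 := ball_subset_closedBall
  have hrd : ∀ x ∈ ball (0 : E) 1, DifferentiableAt ℝ r x := fun x hx =>
    (hr.contDiffAt (hV.mem_nhds (hBV (hball hx)))).differentiableAt one_ne_zero
  obtain ⟨K, hK⟩ := ((hr.sub contDiffOn_id).mono hBV).exists_lipschitzOnWith one_ne_zero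
    (convex_closedBall 0 1) hcompact
  set h : E → E := (closedBall 0 1).indicator fun x => r x - id x with hh
  have hlip : LipschitzWith K h :=
    hK.lipschitzWith_indicator_closedBall fun x hx => by simp [hid x hx]
  have h0 : ∀ x ∉ ball (0 : E) 1, h x = 0 := fun x hx => by
    by_cases hx1 : x ∈ closedBall (0 : E) 1
    · rw [hh, indicator_of_mem hx1, hid x, id, sub_self]
      exact mem_sphere.2 (le_antisymm hx1 (not_lt.1 hx))
    · rw [hh, indicator_of_notMem hx1]
  have hderiv : ∀ x ∈ ball (0 : E) 1, HasFDerivAt h (fderiv ℝ r x - 1) x := fun x hx => by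
    refine ((hrd x hx).hasFDerivAt.sub (hasFDerivAt_id x)).congr_of_eventuallyEq ?_
    filter_upwards [isOpen_ball.mem_nhds hx] with y hy
    rw [hh, indicator_of_mem (hball hy)]
    rfl
  have hint : ∀ t : ℝ, IntegrableOn (fun x => (1 + t • fderiv ℝ h x).det) (ball 0 1) μ := by
    intro t
    have hcont : ContinuousOn (fun x => (1 + t • (fderiv ℝ r x - 1)).det) (closedBall 0 1) := by
      have := (hr.continuousOn_fderiv_of_isOpen hV le_rfl).mono hBV
      exact ContinuousLinearMap.continuous_det.comp_continuousOn (by fun_prop)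
    refine ((hcont.integrableOn_compact hcompact).mono_set hball).congr_fun (fun x hx => ?_)
      measurableSet_ball
    simp only [(hderiv x hx).fderiv]
  have hvol := integral_det_one_add_fderiv μ measurableSet_ball hlip h0
    (fun x hx => (hderiv x hx).differentiableAt) hint
  have hzero : ∫ x in ball (0 : E) 1, (1 + fderiv ℝ h x).det ∂μ = 0 := by
    refine setIntegral_eq_zero_of_forall_eq_zero fun x hx => ?_
    rw [(hderiv x hx).fderiv, add_sub_cancel]
    refine det_fderiv_eq_zero_of_eventually_norm_eq_one (hrd x hx) ?_
    filter_upwards [isOpen_ball.mem_nhds hx] with y hy using hnorm y (hball hy)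
  have hpos : 0 < μ.real (ball (0 : E) 1) :=
    ENNReal.toReal_pos (measure_ball_pos μ 0 one_pos).ne' measure_ball_lt_top.ne
  exact hpos.ne (hzero.symm.trans hvol)

open scoped RealInnerProductSpace

/-- The signed length, in units of `u`, of the segment from `x` in direction `u` to the unit
sphere. -/
noncomputable def sphereRayParam (x u : E) : ℝ :=
  (-⟪x, u⟫ + √(⟪x, u⟫ ^ 2 + ‖u‖ ^ 2 * (1 - ‖x‖ ^ 2))) / ‖u‖ ^ 2

lemma norm_add_sphereRayParam_smul {x u : E} (hu : u ≠ 0)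
    (hD : 0 ≤ ⟪x, u⟫ ^ 2 + ‖u‖ ^ 2 * (1 - ‖x‖ ^ 2)) : ‖x + sphereRayParam x u • u‖ = 1 := by
  have hu' : ‖u‖ ≠ 0 := norm_ne_zero_iff.2 hu
  have hsq := Real.sq_sqrt hD
  rw [← sq_eq_sq₀ (norm_nonneg _) zero_le_one, norm_add_sq_real, norm_smul, mul_pow,
    Real.norm_eq_abs, sq_abs, inner_smul_right, sphereRayParam]
  set S := √(⟪x, u⟫ ^ 2 + ‖u‖ ^ 2 * (1 - ‖x‖ ^ 2))
  field_simp
  linear_combination hsq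

lemma discriminant_pos {x y : E} (hx : ‖x‖ ≤ 1) (hy : ‖y‖ ≤ 1) (hxy : y ≠ x) :
    0 < ⟪x, x - y⟫ ^ 2 + ‖x - y‖ ^ 2 * (1 - ‖x‖ ^ 2) ∧ (‖x‖ = 1 → 0 < ⟪x, x - y⟫) := by
  have hpos : 0 < ‖x - y‖ := norm_sub_pos_iff.2 hxy.symm
  have hinner : ‖x‖ = 1 → 0 < ⟪x, x - y⟫ := fun hx1 => by
    have h1 := norm_sub_sq_real x y
    rw [inner_sub_right, real_inner_self_eq_norm_sq]
    nlinarith [norm_nonneg y]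
  refine ⟨?_, hinner⟩
  rcases hx.lt_or_eq with hlt | heq
  · have : 0 < 1 - ‖x‖ ^ 2 := by nlinarith [norm_nonneg x]
    positivity
  · have := hinner heq
    simp only [heq]
    positivity

lemma exists_fixedPoint_closedBall_of_contDiffOn
    [FiniteDimensional ℝ E] {f : E → E} {U : Set E} (hU : IsOpen U)
    (hBU : closedBall (0 : E) 1 ⊆ U) (hf : ContDiffOn ℝ 1 f U)
    (hmap : MapsTo f (closedBall (0 : E) 1) (closedBall 0 1)) :
    ∃ x ∈ closedBall (0 : E) 1, f x = x := by
  by_contra! hne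
  let D : E → ℝ := fun x => ⟪x, x - f x⟫ ^ 2 + ‖x - f x‖ ^ 2 * (1 - ‖x‖ ^ 2)
  have hu : ContDiffOn ℝ 1 (fun x => x - f x) U := contDiffOn_id.sub hf
  have hD : ContDiffOn ℝ 1 D U :=
    ((contDiffOn_id.inner ℝ hu).pow 2).add
      ((hu.norm_sq ℝ).mul (contDiffOn_const.sub (contDiffOn_id.norm_sq ℝ)))
  let V := (U ∩ D ⁻¹' Ioi 0) ∩ (U ∩ (fun x => x - f x) ⁻¹' {0}ᶜ)
  have hV : IsOpen V := (hD.continuousOn.isOpen_inter_preimage hU isOpen_Ioi).inter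
    (hu.continuousOn.isOpen_inter_preimage hU isOpen_compl_singleton)
  have hball : ∀ x ∈ closedBall (0 : E) 1, 0 < D x ∧ (‖x‖ = 1 → 0 < ⟪x, x - f x⟫) := fun x hx =>
    discriminant_pos (mem_closedBall_zero_iff.1 hx) (mem_closedBall_zero_iff.1 (hmap hx)) (hne x hx)
  have hu0 : ∀ x ∈ closedBall (0 : E) 1, x - f x ≠ 0 := fun x hx => sub_ne_zero.2 (hne x hx).symm
  have hBV : closedBall (0 : E) 1 ⊆ V := fun x hx =>
    ⟨⟨hBU hx, (hball x hx).1⟩, ⟨hBU hx, hu0 x hx⟩⟩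
  have hVU : V ⊆ U := fun x hx => hx.1.1
  refine not_exists_contDiffOn_retraction_sphere
    (r := fun x => x + sphereRayParam x (x - f x) • (x - f x)) hV hBV ?_ (fun x hx => ?_)
    fun x hx => ?_
  · have huV := hu.mono hVU
    refine contDiffOn_id.add (ContDiffOn.smul (ContDiffOn.div (ContDiffOn.add ?_ ?_) ?_ ?_) huV)
    · exact (contDiffOn_id.inner ℝ huV).neg
    · exact (hD.mono hVU).sqrt fun x hx => hx.1.2.ne'
    · exact huV.norm_sq ℝ
    · exact fun x hx => pow_ne_zero 2 (norm_ne_zero_iff.2 hx.2.2)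
  · exact norm_add_sphereRayParam_smul (hu0 x hx) (hball x hx).1.le
  · have hx1 : ‖x‖ = 1 := mem_sphere_zero_iff_norm.1 hx
    have := (hball x (sphere_subset_closedBall hx)).2 hx1
    simp [sphereRayParam, hx1, Real.sqrt_sq this.le]

end Retraction

/-- Smooth Brouwer fixed point theorem: any map `f : ℝⁿ → ℝⁿ` which is `C²` on
a neighborhood of the closed unit ball `B` and maps `B` into `B` has a fixed
point in `B`. -/
theorem smooth_brouwer_fixed_point
    (n : ℕ) (hn : 1 ≤ n)
    (f : EuclideanSpace ℝ (Fin n) → EuclideanSpace ℝ (Fin n))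
    (U : Set (EuclideanSpace ℝ (Fin n))) (hUopen : IsOpen U)
    (hBU : Metric.closedBall (0 : EuclideanSpace ℝ (Fin n)) 1 ⊆ U)
    (hf : ContDiffOn ℝ 2 f U)
    (hmap : Set.MapsTo f (Metric.closedBall (0 : EuclideanSpace ℝ (Fin n)) 1)
      (Metric.closedBall (0 : EuclideanSpace ℝ (Fin n)) 1)) :
    ∃ x ∈ Metric.closedBall (0 : EuclideanSpace ℝ (Fin n)) 1, f x = x :=
  exists_fixedPoint_closedBall_of_contDiffOn hUopen hBU (hf.of_le one_le_two) hmap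
end
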